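/- (Weak-type characterization by global testing.) Let 1 < p < q < ∞, let τ = (τ_Q)_{Q∈𝒬} be nonnegative constants, and let σ, ω be weights on ℝ^d. Let 𝔑 be the least constant N ∈ [0,∞] such that ω({x : T_τ(fσ)(x) > λ}) ≤ (N ‖f‖_{L^p(σ)} / λ)^q for all λ > 0 and all nonnegative f ∈ L^p(σ), and let 𝔊 = ⟦σ,ω⟧^Glo_{τ,p,q} be the global testing constant. Then there are constants c, C > 0 depending only on p, q, d such that c·𝔊 ≤ 𝔑 ≤ C·𝔊, both sides understood in [0,∞]. -/

import Mathlib

open MeasureTheory ENNReal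

noncomputable section

/-- Index set for dyadic cubes of `ℝ^d`: a scale `k : ℤ` and a position `n ∈ ℤ^d`. -/
abbrev DIdx (d : ℕ) : Type := ℤ × (Fin d → ℤ)

/-- The dyadic cube `∏_j [2^k n_j, 2^k (n_j + 1))` of `ℝ^d`. -/
def dcube {d : ℕ} (i : DIdx d) : Set (Fin d → ℝ) :=
  {x | ∀ j, x j ∈ Set.Ico ((2 : ℝ) ^ i.1 * (i.2 j : ℝ)) ((2 : ℝ) ^ i.1 * ((i.2 j : ℝ) + 1))}

/-- The dyadic parent of a dyadic cube: the minimal dyadic cube strictly containing it. -/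
def dparent {d : ℕ} (i : DIdx d) : DIdx d :=
  (i.1 + 1, fun j => Int.fdiv (i.2 j) 2)

/-- The measure `ω dx` on `ℝ^d` associated with a weight `ω`. -/
def wMeasure {d : ℕ} (ω : (Fin d → ℝ) → ℝ≥0∞) : Measure (Fin d → ℝ) :=
  volume.withDensity ω

/-- The average of a nonnegative function `f` over the dyadic cube indexed by `i`,
with respect to the measure `μ`. -/
def cavg {d : ℕ} (μ : Measure (Fin d → ℝ)) (i : DIdx d) (f : (Fin d → ℝ) → ℝ≥0∞) : ℝ≥0∞ :=
  (∫⁻ x in dcube i, f x ∂μ) / μ (dcube i)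

/-- Lebesgue average of a nonnegative function over a dyadic cube. -/
def lavg {d : ℕ} (i : DIdx d) (f : (Fin d → ℝ) → ℝ≥0∞) : ℝ≥0∞ :=
  cavg volume i f

/-- The `L^p` norm (real exponent `p`) of a nonnegative function with respect to `μ`. -/
def lpn {d : ℕ} (p : ℝ) (μ : Measure (Fin d → ℝ)) (f : (Fin d → ℝ) → ℝ≥0∞) : ℝ≥0∞ :=
  (∫⁻ x, f x ^ p ∂μ) ^ (1 / p)

/-- The positive dyadic operator `T_τ f = ∑_Q τ_Q (E_Q f) 1_Q`. -/
def Tdy {d : ℕ} (τ : DIdx d → ℝ≥0∞) (f : (Fin d → ℝ) → ℝ≥0∞) (x : Fin d → ℝ) : ℝ≥0∞ :=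
  ∑' i : DIdx d, (dcube i).indicator (fun _ => τ i * lavg i f) x

/-- The local part `T^in_{τ,R} f = ∑_{Q ⊆ R} τ_Q (E_Q f) 1_Q`. -/
def TdyIn {d : ℕ} (τ : DIdx d → ℝ≥0∞) (R : DIdx d) (f : (Fin d → ℝ) → ℝ≥0∞)
    (x : Fin d → ℝ) : ℝ≥0∞ :=
  ∑' i : {i : DIdx d // dcube i ⊆ dcube R},
    (dcube i.1).indicator (fun _ => τ i.1 * lavg i.1 f) x

/-- The global part `T^out_{τ,R} f = ∑_{Q ⊇ R} τ_Q (E_Q f) 1_Q`. -/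
def TdyOut {d : ℕ} (τ : DIdx d → ℝ≥0∞) (R : DIdx d) (f : (Fin d → ℝ) → ℝ≥0∞)
    (x : Fin d → ℝ) : ℝ≥0∞ :=
  ∑' i : {i : DIdx d // dcube R ⊆ dcube i},
    (dcube i.1).indicator (fun _ => τ i.1 * lavg i.1 f) x

/-- The local testing constant `⟦σ,ω⟧^Loc_{τ,p,q}
= sup_{R : ω(R)>0} ω(R)^{-1/q'} ‖T^in_{τ,R}(1_R ω)‖_{L^{p'}(σ)}`. -/
def locTest {d : ℕ} (p q : ℝ) (τ : DIdx d → ℝ≥0∞) (σ ω : (Fin d → ℝ) → ℝ≥0∞) : ℝ≥0∞ :=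
  ⨆ (R : DIdx d) (_ : wMeasure ω (dcube R) ≠ 0),
    wMeasure ω (dcube R) ^ (-(1 / (q / (q - 1)))) *
      lpn (p / (p - 1)) (wMeasure σ) (TdyIn τ R ((dcube R).indicator ω))

/-- The global testing constant `⟦σ,ω⟧^Glo_{τ,p,q}
= sup_{R : ω(R)>0} ω(R)^{-1/q'} ‖T^out_{τ,R}(1_R ω)‖_{L^{p'}(σ)}`. -/
def gloTest {d : ℕ} (p q : ℝ) (τ : DIdx d → ℝ≥0∞) (σ ω : (Fin d → ℝ) → ℝ≥0∞) : ℝ≥0∞ :=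
  ⨆ (R : DIdx d) (_ : wMeasure ω (dcube R) ≠ 0),
    wMeasure ω (dcube R) ^ (-(1 / (q / (q - 1)))) *
      lpn (p / (p - 1)) (wMeasure σ) (TdyOut τ R ((dcube R).indicator ω))

/-- The least weak-type `L^p(σ) → L^{q,∞}(ω)` constant of `f ↦ T_τ(fσ)`. -/
def weakConst {d : ℕ} (p q : ℝ) (τ : DIdx d → ℝ≥0∞) (σ ω : (Fin d → ℝ) → ℝ≥0∞) : ℝ≥0∞ :=
  sInf {N : ℝ≥0∞ | ∀ f : (Fin d → ℝ) → ℝ≥0∞, Measurable f → lpn p (wMeasure σ) f ≠ ⊤ →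
    ∀ lam : ℝ≥0∞, 0 < lam →
      wMeasure ω {x | lam < Tdy τ (fun y => f y * σ y) x} ≤
        (N * lpn p (wMeasure σ) f / lam) ^ q}


/-- A dyadic cube is a product of half-open intervals. -/
lemma dcube_eq_pi {d : ℕ} (i : DIdx d) :
    dcube i = Set.univ.pi fun j =>
      Set.Ico ((2 : ℝ) ^ i.1 * (i.2 j : ℝ)) ((2 : ℝ) ^ i.1 * ((i.2 j : ℝ) + 1)) := by
  ext x; simp [dcube]

lemma measurableSet_dcube {d : ℕ} (i : DIdx d) : MeasurableSet (dcube i) := by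
  rw [dcube_eq_pi]
  exact MeasurableSet.univ_pi fun _ => measurableSet_Ico

/-- Two intersecting dyadic cubes are nested, the one of smaller scale being the smaller one. -/
lemma dcube_subset_of_mem {d : ℕ} {i j : DIdx d} (hij : i.1 ≤ j.1) {x : Fin d → ℝ}
    (hi : x ∈ dcube i) (hj : x ∈ dcube j) : dcube i ⊆ dcube j := by
  intro y hy l
  obtain ⟨t, ht⟩ := Int.le.dest hij
  have h2 : (2 : ℝ) ^ j.1 = 2 ^ i.1 * ((2 ^ t : ℤ) : ℝ) := by
    rw [← ht, zpow_add₀ two_ne_zero]; simp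
  have hpos : (0 : ℝ) < 2 ^ i.1 := by positivity
  obtain ⟨a1, a2⟩ := hi l
  obtain ⟨b1, b2⟩ := hj l
  obtain ⟨c1, c2⟩ := hy l
  rw [h2, mul_assoc] at b1 b2
  have e1 : (2 ^ t : ℤ) * j.2 l < i.2 l + 1 := by
    have := lt_of_mul_lt_mul_left (b1.trans_lt a2) hpos.le
    exact_mod_cast this
  have e2 : i.2 l < (2 ^ t : ℤ) * (j.2 l + 1) := by
    have := lt_of_mul_lt_mul_left (a1.trans_lt b2) hpos.le
    exact_mod_cast this
  have f1 : (((2 ^ t : ℤ) : ℝ) * j.2 l) ≤ i.2 l := by exact_mod_cast Int.lt_add_one_iff.1 e1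
  have f2 : (i.2 l : ℝ) + 1 ≤ ((2 ^ t : ℤ) : ℝ) * (j.2 l + 1) := by
    exact_mod_cast Int.add_one_le_iff.2 e2
  rw [h2, mul_assoc, mul_assoc]
  exact ⟨(mul_le_mul_of_nonneg_left f1 hpos.le).trans c1,
    c2.trans_le (mul_le_mul_of_nonneg_left f2 hpos.le)⟩

lemma dcube_subset_or_subset {d : ℕ} {i j : DIdx d} {x : Fin d → ℝ}
    (hi : x ∈ dcube i) (hj : x ∈ dcube j) : dcube i ⊆ dcube j ∨ dcube j ⊆ dcube i :=
  (le_total i.1 j.1).imp (fun h => dcube_subset_of_mem h hi hj)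
    fun h => dcube_subset_of_mem h hj hi

lemma exists_mem_dcube {d : ℕ} (x : Fin d → ℝ) : ∃ i : DIdx d, x ∈ dcube i :=
  ⟨(0, fun j => ⌊x j⌋), fun j => by simp [Int.floor_le, Int.lt_floor_add_one]⟩

/-- A measure that is finite on dyadic cubes is σ-finite. -/
lemma sigmaFinite_of_dcube_ne_top {d : ℕ} {μ : Measure (Fin d → ℝ)}
    (h : ∀ i : DIdx d, μ (dcube i) ≠ ⊤) : SigmaFinite μ := by
  refine Measure.sigmaFinite_of_countable (Set.countable_range (dcube (d := d))) ?_ ?_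
  · rintro _ ⟨i, rfl⟩
    exact (h i).lt_top
  · refine Set.eq_univ_of_forall fun x => ?_
    obtain ⟨i, hi⟩ := exists_mem_dcube x
    exact ⟨_, ⟨i, rfl⟩, hi⟩

/-- The converse of Hölder's inequality in `L^p`, for nonnegative functions. -/
lemma lpn_le_of_forall_lintegral_mul_le {d : ℕ} {p r : ℝ} (hpr : p.HolderConjugate r)
    {μ : Measure (Fin d → ℝ)} [SigmaFinite μ] {g : (Fin d → ℝ) → ℝ≥0∞} (hg : Measurable g)
    {M : ℝ≥0∞}
    (h : ∀ f : (Fin d → ℝ) → ℝ≥0∞, Measurable f → lpn p μ f ≠ ⊤ →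
      ∫⁻ x, g x * f x ∂μ ≤ M * lpn p μ f) : lpn r μ g ≤ M := by
  have hp := hpr.pos
  have hr := hpr.symm.pos
  set u : ℕ → (Fin d → ℝ) → ℝ≥0∞ := fun n x =>
    (spanningSets μ n).indicator (fun x => min (g x) n) x with hu
  have hum : ∀ n, Measurable (u n) := fun n =>
    (hg.min measurable_const).indicator (measurableSet_spanningSets μ n)
  have hug : ∀ n x, u n x ≤ g x := fun n x =>
    (Set.indicator_le_self _ _ _).trans (min_le_left _ _)
  have humono : Monotone u := by
    intro m n hmn x
    refine Set.indicator_le_indicator_of_subset (monotone_spanningSets μ hmn) (by simp) x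
      |>.trans ?_
    exact Set.indicator_le_indicator (min_le_min le_rfl (by exact_mod_cast hmn))
  have husup : ∀ x, ⨆ n, u n x = g x := by
    intro x
    refine le_antisymm (iSup_le fun n => hug n x) ?_
    refine le_of_forall_lt fun c hc => ?_
    obtain ⟨n, hn⟩ := ENNReal.exists_nat_gt (ne_top_of_lt hc)
    set m := max n (spanningSetsIndex μ x)
    refine lt_of_lt_of_le ?_ (le_iSup _ m)
    have hx : x ∈ spanningSets μ m :=
      monotone_spanningSets μ (le_max_right _ _) (mem_spanningSetsIndex μ x)
    simp only [hu, Set.indicator_of_mem hx]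
    exact lt_min hc (hn.trans_le (by exact_mod_cast le_max_left _ _))
  have hsup : ⨆ n, ∫⁻ x, u n x ^ r ∂μ = ∫⁻ x, g x ^ r ∂μ := by
    rw [← lintegral_iSup (fun n => (hum n).pow_const r)
      (fun m n hmn x => ENNReal.rpow_le_rpow (humono hmn x) hr.le)]
    refine lintegral_congr fun x => ?_
    rw [← husup x]
    exact ((ENNReal.orderIsoRpow r hr).map_iSup fun n => u n x).symm
  have hfin : ∀ n, ∫⁻ x, u n x ^ r ∂μ ≠ ⊤ := by
    intro n
    have : ∀ x, u n x ^ r ≤ (spanningSets μ n).indicator (fun _ => (n : ℝ≥0∞) ^ r) x := by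
      intro x
      by_cases hx : x ∈ spanningSets μ n
      · simp only [hu, Set.indicator_of_mem hx]
        exact ENNReal.rpow_le_rpow (min_le_right _ _) hr.le
      · simp [hu, Set.indicator_of_notMem hx, hr]
    refine ne_top_of_le_ne_top ?_ (lintegral_mono this)
    rw [lintegral_indicator_const (measurableSet_spanningSets μ n)]
    exact ENNReal.mul_ne_top (ENNReal.rpow_ne_top_of_nonneg hr.le (natCast_ne_top n))
      (measure_spanningSets_lt_top μ n).ne
  have hmain : ∀ n, ∫⁻ x, u n x ^ r ∂μ ≤ M ^ r := by
    intro n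
    set I := ∫⁻ x, u n x ^ r ∂μ with hI
    have hfp : ∀ x, (u n x ^ (r - 1)) ^ p = u n x ^ r := fun x => by
      rw [← ENNReal.rpow_mul, hpr.symm.sub_one_mul_conj]
    have hl : lpn p μ (fun x => u n x ^ (r - 1)) = I ^ (1 / p) := by
      simp only [lpn, hfp, hI]
    have h1 := h (fun x => u n x ^ (r - 1)) ((hum n).pow_const _)
      (by rw [hl]; exact ENNReal.rpow_ne_top_of_nonneg (by positivity) (hfin n))
    have h2 : I ≤ M * I ^ (1 / p) := by
      rw [hl] at h1
      refine le_trans (lintegral_mono fun x => ?_) h1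
      calc u n x ^ r = u n x ^ (1 : ℝ) * u n x ^ (r - 1) := by
            rw [← ENNReal.rpow_add_of_nonneg _ _ zero_le_one hpr.symm.sub_one_pos.le]; ring_nf
        _ ≤ g x * u n x ^ (r - 1) := by rw [ENNReal.rpow_one]; gcongr; exact hug n x
    by_cases h0 : I = 0
    · rw [h0]; exact zero_le
    have hIr : I = I ^ (1 / r) * I ^ (1 / p) := by
      rw [← ENNReal.rpow_add _ _ h0 (hfin n), one_div, one_div, add_comm, hpr.inv_add_inv_eq_one,
        ENNReal.rpow_one]
    have h3 : I ^ (1 / r) ≤ M := by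
      have h4 : I ^ (1 / r) * I ^ (1 / p) ≤ M * I ^ (1 / p) := hIr ▸ h2
      refine (ENNReal.mul_le_mul_iff_left ?_ ?_).1 h4
      · simp [h0, hp.le]
      · exact ENNReal.rpow_ne_top_of_nonneg (by positivity) (hfin n)
    rwa [one_div, ENNReal.rpow_inv_le_iff hr] at h3
  rw [lpn, one_div, ENNReal.rpow_inv_le_iff hr, ← hsup]
  exact iSup_le hmain

/-- The kernel `∑_{Q ⊇ R} τ_Q |Q|⁻¹ 1_Q` of the global part of `T_τ` at `R`. -/
def kerOut {d : ℕ} (τ : DIdx d → ℝ≥0∞) (R : DIdx d) (x : Fin d → ℝ) : ℝ≥0∞ :=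
  ∑' i : DIdx d, {i | dcube R ⊆ dcube i}.indicator
    (fun i => (dcube i).indicator (fun _ => τ i / volume (dcube i)) x) i

lemma measurable_kerOut {d : ℕ} (τ : DIdx d → ℝ≥0∞) (R : DIdx d) : Measurable (kerOut τ R) := by
  refine Measurable.tsum fun i => ?_
  by_cases hi : dcube R ⊆ dcube i
  · simp only [Set.indicator_of_mem (show i ∈ {i | dcube R ⊆ dcube i} from hi)]
    exact measurable_const.indicator (measurableSet_dcube i)
  · simp [Set.indicator, hi]

lemma tdyOut_indicator {d : ℕ} (τ : DIdx d → ℝ≥0∞) (R : DIdx d) (ω : (Fin d → ℝ) → ℝ≥0∞)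
    (x : Fin d → ℝ) :
    TdyOut τ R ((dcube R).indicator ω) x = wMeasure ω (dcube R) * kerOut τ R x := by
  rw [TdyOut, kerOut, ← tsum_subtype, ← ENNReal.tsum_mul_left]
  refine tsum_congr fun i => ?_
  have hR := measurableSet_dcube R
  have hi : dcube R ⊆ dcube i.1 := i.2
  by_cases hx : x ∈ dcube i.1
  · simp only [Set.indicator_of_mem hx, lavg, cavg]
    rw [lintegral_indicator hR, Measure.restrict_restrict hR, Set.inter_eq_left.2 hi, wMeasure,
      withDensity_apply _ hR, div_eq_mul_inv, div_eq_mul_inv]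
    ring
  · simp [Set.indicator_of_notMem hx]

lemma lintegral_indicator_mul_wMeasure {d : ℕ} {σ : (Fin d → ℝ) → ℝ≥0∞} (hσ : Measurable σ)
    {f : (Fin d → ℝ) → ℝ≥0∞} (hf : Measurable f) (i : DIdx d) (c : ℝ≥0∞) :
    ∫⁻ x, (dcube i).indicator (fun _ => c / volume (dcube i)) x * f x ∂wMeasure σ =
      c * lavg i (fun y => f y * σ y) := by
  have hi := measurableSet_dcube i
  have : ∀ x, (dcube i).indicator (fun _ => c / volume (dcube i)) x * f x =
      (dcube i).indicator (fun x => c / volume (dcube i) * f x) x := fun x => by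
    by_cases hx : x ∈ dcube i <;> simp [hx]
  simp only [this]
  rw [lintegral_indicator hi, lintegral_const_mul _ hf, wMeasure,
    setLIntegral_withDensity_eq_setLIntegral_mul _ hσ hf hi, lavg, cavg, div_eq_mul_inv,
    div_eq_mul_inv]
  simp only [Pi.mul_apply, mul_comm (σ _)]
  ring

lemma lintegral_kerOut_mul {d : ℕ} (τ : DIdx d → ℝ≥0∞) (R : DIdx d)
    {σ : (Fin d → ℝ) → ℝ≥0∞} (hσ : Measurable σ)
    {f : (Fin d → ℝ) → ℝ≥0∞} (hf : Measurable f) :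
    ∫⁻ x, kerOut τ R x * f x ∂wMeasure σ =
      ∑' i : DIdx d, {i | dcube R ⊆ dcube i}.indicator
        (fun i => τ i * lavg i (fun y => f y * σ y)) i := by
  simp only [kerOut, ← ENNReal.tsum_mul_right]
  rw [lintegral_tsum]
  · refine tsum_congr fun i => ?_
    by_cases hi : dcube R ⊆ dcube i
    · simpa [Set.indicator, hi] using lintegral_indicator_mul_wMeasure hσ hf i (τ i)
    · simp [Set.indicator, hi]
  · intro i
    by_cases hi : dcube R ⊆ dcube i
    · simp only [Set.indicator_of_mem (show i ∈ {i | dcube R ⊆ dcube i} from hi)]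
      exact ((measurable_const.indicator (measurableSet_dcube i)).mul hf).aemeasurable
    · simp [Set.indicator, hi]

/-- On `R`, the operator `T_τ` dominates the pairing with the global kernel at `R`. -/
lemma lintegral_kerOut_mul_le_tdy {d : ℕ} (τ : DIdx d → ℝ≥0∞) (R : DIdx d)
    {σ : (Fin d → ℝ) → ℝ≥0∞} (hσ : Measurable σ)
    {f : (Fin d → ℝ) → ℝ≥0∞} (hf : Measurable f) {x : Fin d → ℝ} (hx : x ∈ dcube R) :
    ∫⁻ x, kerOut τ R x * f x ∂wMeasure σ ≤ Tdy τ (fun y => f y * σ y) x := by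
  rw [lintegral_kerOut_mul τ R hσ hf, Tdy]
  refine ENNReal.tsum_le_tsum fun i => ?_
  by_cases hi : dcube R ⊆ dcube i
  · simp [Set.indicator, hi, hi hx]
  · simp [Set.indicator, hi]

lemma lpn_const_mul {d : ℕ} {r : ℝ} (hr : 0 < r) (μ : Measure (Fin d → ℝ)) (c : ℝ≥0∞)
    {g : (Fin d → ℝ) → ℝ≥0∞} (hg : Measurable g) :
    lpn r μ (fun x => c * g x) = c * lpn r μ g := by
  simp only [lpn, ENNReal.mul_rpow_of_nonneg _ _ hr.le]
  rw [lintegral_const_mul _ (hg.pow_const r), ENNReal.mul_rpow_of_nonneg _ _ (by positivity),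
    ← ENNReal.rpow_mul, mul_one_div_cancel hr.ne', ENNReal.rpow_one]

lemma lpn_mono {d : ℕ} {r : ℝ} (hr : 0 < r) (μ : Measure (Fin d → ℝ))
    {f g : (Fin d → ℝ) → ℝ≥0∞} (h : ∀ x, f x ≤ g x) : lpn r μ f ≤ lpn r μ g :=
  ENNReal.rpow_le_rpow (lintegral_mono fun x => ENNReal.rpow_le_rpow (h x) hr.le) (by positivity)

/-- The global testing constant in terms of the kernels: `sup_R ω(R)^{1/q} ‖K_R‖_{L^{p'}(σ)}`. -/
lemma gloTest_eq {d : ℕ} {p q : ℝ} (hp : 1 < p) (hq : 1 < q) (τ : DIdx d → ℝ≥0∞)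
    (σ ω : (Fin d → ℝ) → ℝ≥0∞) (hω : ∀ i : DIdx d, wMeasure ω (dcube i) ≠ ⊤) :
    gloTest p q τ σ ω = ⨆ (R : DIdx d) (_ : wMeasure ω (dcube R) ≠ 0),
      wMeasure ω (dcube R) ^ (1 / q) * lpn (p / (p - 1)) (wMeasure σ) (kerOut τ R) := by
  refine iSup_congr fun R => iSup_congr fun h0 => ?_
  have hr : 0 < p / (p - 1) := div_pos (by linarith) (by linarith)
  rw [funext (tdyOut_indicator τ R ω), lpn_const_mul hr _ _ (measurable_kerOut τ R), ← mul_assoc]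
  congr 1
  nth_rewrite 2 [← ENNReal.rpow_one (wMeasure ω (dcube R))]
  rw [← ENNReal.rpow_add _ _ h0 (hω R)]
  congr 1
  field_simp
  ring

lemma gloTest_le_weakConst {d : ℕ} {p q : ℝ} (hp : 1 < p) (hq : 1 < q) (τ : DIdx d → ℝ≥0∞)
    {σ ω : (Fin d → ℝ) → ℝ≥0∞} (hσ : Measurable σ)
    (hσt : ∀ i : DIdx d, wMeasure σ (dcube i) ≠ ⊤)
    (hωt : ∀ i : DIdx d, wMeasure ω (dcube i) ≠ ⊤) :
    gloTest p q τ σ ω ≤ weakConst p q τ σ ω := by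
  have := sigmaFinite_of_dcube_ne_top hσt
  have hq0 : 0 < q := by linarith
  refine le_sInf fun N hN => ?_
  rw [gloTest_eq hp hq τ σ ω hωt]
  refine iSup₂_le fun R h0 => ?_
  set w := wMeasure ω (dcube R)
  have hw0 : w ^ (1 / q) ≠ 0 := by simp [h0, hωt R, w]
  have hwt : w ^ (1 / q) ≠ ⊤ := ENNReal.rpow_ne_top_of_nonneg (by positivity) (hωt R)
  have hpr : p.HolderConjugate (p / (p - 1)) := Real.HolderConjugate.conjExponent hp
  refine ENNReal.mul_le_of_le_div' ?_
  refine lpn_le_of_forall_lintegral_mul_le hpr (measurable_kerOut τ R) fun f hf hft => ?_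
  rw [ENNReal.mul_comm_div, ← mul_div_assoc, ENNReal.le_div_iff_mul_le (Or.inl hw0) (Or.inl hwt)]
  refine ENNReal.mul_le_of_forall_lt fun lam hlam v hv => ?_
  rcases eq_or_ne lam 0 with rfl | hl
  · simp
  have hlt : lam ≠ ⊤ := ne_top_of_lt hlam
  have h1 : w ≤ (N * lpn p (wMeasure σ) f / lam) ^ q := by
    refine le_trans (measure_mono fun x hx => ?_) (hN f hf hft lam (pos_iff_ne_zero.2 hl))
    exact hlam.trans_le (lintegral_kerOut_mul_le_tdy τ R hσ hf hx)
  rw [← ENNReal.rpow_inv_le_iff hq0, ← one_div, ENNReal.le_div_iff_mul_le (Or.inl hl) (Or.inl hlt)]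
    at h1
  calc lam * v ≤ w ^ (1 / q) * lam := by rw [mul_comm]; gcongr
    _ ≤ _ := h1

/-- `a ‖K_R‖_{p'} ≤ 𝔊 a^{1 - 1/q}` for `a ≤ ω(R)`. -/
lemma mul_lpn_kerOut_le {d : ℕ} {p q : ℝ} (hp : 1 < p) (hq : 1 < q)
    (τ : DIdx d → ℝ≥0∞) (σ ω : (Fin d → ℝ) → ℝ≥0∞)
    (hω : ∀ i : DIdx d, wMeasure ω (dcube i) ≠ ⊤) (R : DIdx d) {a : ℝ≥0∞}
    (ha : a ≤ wMeasure ω (dcube R)) :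
    a * lpn (p / (p - 1)) (wMeasure σ) (kerOut τ R) ≤ gloTest p q τ σ ω * a ^ (1 - 1 / q) := by
  rcases eq_or_ne a 0 with rfl | h0
  · simp
  have hq0 : 0 < q := by linarith
  have hat : a ≠ ⊤ := ne_top_of_le_ne_top (hω R) ha
  have hR : wMeasure ω (dcube R) ≠ 0 := fun h => h0 (le_zero_iff.1 (h ▸ ha))
  calc a * lpn (p / (p - 1)) (wMeasure σ) (kerOut τ R)
      = a ^ (1 / q) * lpn (p / (p - 1)) (wMeasure σ) (kerOut τ R) * a ^ (1 - 1 / q) := by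
        nth_rewrite 1 [← ENNReal.rpow_one a, show (1 : ℝ) = 1 / q + (1 - 1 / q) by ring,
          ENNReal.rpow_add _ _ h0 hat]
        ring
    _ ≤ _ := by
        gcongr
        rw [gloTest_eq hp hq τ σ ω hω]
        refine le_trans ?_ (le_iSup₂ R hR)
        gcongr

open Classical in
/-- Norm estimate for the part of `T_τ(1_E ω)` over finitely many cubes `Q` for which `ω(E ∩ Q)` is
comparable to a fixed number `b`: bound the sum at each point by a kernel over a minimal cube, and
use that the minimal cubes are disjoint. -/
lemma lintegral_layer_rpow_le {d : ℕ} {r t θ : ℝ} (hr : 0 < r) (hθ : 0 ≤ θ)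
    (hrt : r * t = 1 + r * θ) (τ : DIdx d → ℝ≥0∞) (μ ν : Measure (Fin d → ℝ)) (G : ℝ≥0∞)
    (hG : ∀ (R : DIdx d) (a : ℝ≥0∞), a ≤ ν (dcube R) → a * lpn r μ (kerOut τ R) ≤ G * a ^ t)
    {E : Set (Fin d → ℝ)} (hE : MeasurableSet E) (b : ℝ≥0∞) (F : Finset (DIdx d))
    (hFb : ∀ i ∈ F, ν (E ∩ dcube i) ≤ b) (hbF : ∀ i ∈ F, b ≤ 2 * ν (E ∩ dcube i)) :
    ∫⁻ x, (∑ i ∈ F, (dcube i).indicator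
      (fun _ => τ i * ν (E ∩ dcube i) / volume (dcube i)) x) ^ r ∂μ ≤
        (2 * G * b ^ θ) ^ r * ν E := by
  set S : Finset (Set (Fin d → ℝ)) := F.image dcube
  set 𝓜 := S.filter (Minimal (· ∈ S))
  set g : DIdx d → (Fin d → ℝ) → ℝ≥0∞ := fun i => (dcube i).indicator
    (fun _ => τ i * ν (E ∩ dcube i) / volume (dcube i)) with hg
  have hgm : ∀ i, Measurable (g i) := fun i =>
    measurable_const.indicator (measurableSet_dcube i)
  set h : Set (Fin d → ℝ) → (Fin d → ℝ) → ℝ≥0∞ := fun M x =>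
    ∑ i ∈ F with M ⊆ dcube i, g i x with hh
  have hhm : ∀ M, Measurable (h M) := fun M => Finset.measurable_sum _ fun i _ => hgm i
  have hpt : ∀ x, (∑ i ∈ F, g i x) ^ r ≤ ∑ M ∈ 𝓜, h M x ^ r := by
    intro x
    by_cases hx : ∃ i ∈ F, x ∈ dcube i
    · obtain ⟨i, hiF, hix⟩ := hx
      obtain ⟨Q, -, hQ⟩ := Finset.exists_le_minimal (S.filter (x ∈ ·))
        (Finset.mem_filter.2 ⟨Finset.mem_image_of_mem dcube hiF, hix⟩)
      obtain ⟨hQS, hxQ⟩ := Finset.mem_filter.1 hQ.prop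
      obtain ⟨M, hMQ, hM⟩ := Finset.exists_le_minimal S hQS
      have hsum : ∑ i ∈ F, g i x ≤ h M x := by
        simp only [hh, Finset.sum_filter]
        refine Finset.sum_le_sum fun j hj => ?_
        by_cases hxj : x ∈ dcube j
        · have hjQ : Q ⊆ dcube j := by
            obtain ⟨i', -, rfl⟩ := Finset.mem_image.1 hQS
            rcases dcube_subset_or_subset hxQ hxj with h1 | h1
            · exact h1
            · exact hQ.le_of_le
                (Finset.mem_filter.2 ⟨Finset.mem_image_of_mem dcube hj, hxj⟩) h1
          rw [if_pos (Set.Subset.trans hMQ hjQ)]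
        · simp [hg, hxj]
      calc (∑ i ∈ F, g i x) ^ r ≤ h M x ^ r := ENNReal.rpow_le_rpow hsum hr.le
        _ ≤ _ := Finset.single_le_sum (f := fun M => h M x ^ r) (fun _ _ => zero_le)
          (Finset.mem_filter.2 ⟨hM.prop, hM⟩)
    · rw [Finset.sum_eq_zero fun i hi => ?_, ENNReal.zero_rpow_of_pos hr]
      · exact zero_le
      · exact Set.indicator_of_notMem (fun hxi => hx ⟨i, hi, hxi⟩) _
  have hM : ∀ M ∈ 𝓜, ∫⁻ x, h M x ^ r ∂μ ≤ (2 * G * b ^ θ) ^ r * ν (E ∩ M) := by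
    intro M hM
    obtain ⟨R, hRF, rfl⟩ := Finset.mem_image.1 (Finset.mem_filter.1 hM).1
    set a := ν (E ∩ dcube R)
    have hle : ∀ x, h (dcube R) x ≤ 2 * a * kerOut τ R x := by
      intro x
      rw [kerOut, ← ENNReal.tsum_mul_left]
      refine le_trans ?_ (ENNReal.sum_le_tsum F)
      simp only [hh, Finset.sum_filter]
      refine Finset.sum_le_sum fun i hi => ?_
      by_cases hRi : dcube R ⊆ dcube i
      · by_cases hxi : x ∈ dcube i
        · simp only [hg, hRi, hxi, if_true, Set.indicator_of_mem, Set.mem_ofPred_eq]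
          rw [mul_comm (τ i), mul_div_assoc]
          gcongr
          exact (hFb i hi).trans (hbF R hRF)
        · simp [hg, hxi]
      · simp [hRi]
    have h1 : lpn r μ (h (dcube R)) ≤ 2 * (G * a ^ t) := by
      refine (lpn_mono hr μ hle).trans ?_
      rw [lpn_const_mul hr μ _ (measurable_kerOut τ R), mul_assoc]
      exact mul_le_mul_right (hG R a (measure_mono Set.inter_subset_right)) 2
    rw [lpn, one_div, ENNReal.rpow_inv_le_iff hr] at h1
    calc ∫⁻ x, h (dcube R) x ^ r ∂μ ≤ (2 * (G * a ^ t)) ^ r := h1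
      _ = (2 * G) ^ r * (a ^ (r * θ) * a) := by
        rw [← mul_assoc, ENNReal.mul_rpow_of_nonneg _ _ hr.le, ← ENNReal.rpow_mul, mul_comm t, hrt,
          ENNReal.rpow_add_of_nonneg _ _ zero_le_one (by positivity), ENNReal.rpow_one, mul_comm a]
      _ ≤ (2 * G) ^ r * (b ^ (r * θ) * a) := by
        gcongr
        exact hFb R hRF
      _ = (2 * G * b ^ θ) ^ r * a := by
        rw [ENNReal.mul_rpow_of_nonneg (2 * G) _ hr.le, ← ENNReal.rpow_mul, mul_comm θ, mul_assoc]
  have hdisj : (𝓜 : Set (Set (Fin d → ℝ))).PairwiseDisjoint fun M => E ∩ M := by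
    intro M hM M' hM' hne
    refine Set.disjoint_left.2 fun x hx hx' => hne ?_
    obtain ⟨hMS, hMmin⟩ := Finset.mem_filter.1 hM
    obtain ⟨hMS', hMmin'⟩ := Finset.mem_filter.1 hM'
    obtain ⟨i, -, rfl⟩ := Finset.mem_image.1 hMS
    obtain ⟨j, -, rfl⟩ := Finset.mem_image.1 hMS'
    rcases dcube_subset_or_subset hx.2 hx'.2 with h1 | h1
    · exact Set.Subset.antisymm h1 (hMmin'.le_of_le hMS h1)
    · exact Set.Subset.antisymm (hMmin.le_of_le hMS' h1) h1
  calc ∫⁻ x, (∑ i ∈ F, g i x) ^ r ∂μ ≤ ∫⁻ x, ∑ M ∈ 𝓜, h M x ^ r ∂μ := lintegral_mono hpt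
    _ = ∑ M ∈ 𝓜, ∫⁻ x, h M x ^ r ∂μ :=
      lintegral_finsetSum _ fun M _ => (hhm M).pow_const r
    _ ≤ ∑ M ∈ 𝓜, (2 * G * b ^ θ) ^ r * ν (E ∩ M) := Finset.sum_le_sum hM
    _ = (2 * G * b ^ θ) ^ r * ν (⋃ M ∈ 𝓜, E ∩ M) := by
      rw [← Finset.mul_sum, measure_biUnion_finset hdisj]
      intro M hM
      obtain ⟨i, -, rfl⟩ := Finset.mem_image.1 (Finset.mem_filter.1 hM).1
      exact hE.inter (measurableSet_dcube i)
    _ ≤ _ := by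
      gcongr
      exact Set.iUnion₂_subset fun _ _ => Set.inter_subset_left

/-- For `0 < a ≤ W < ∞`, some `W 2^{-k}` is comparable to `a`. -/
lemma exists_nat_le_mul_inv_two_pow {a W : ℝ≥0∞} (ha : a ≠ 0) (haW : a ≤ W) (hW : W ≠ ⊤) :
    ∃ k : ℕ, a ≤ W * 2⁻¹ ^ k ∧ W * 2⁻¹ ^ k ≤ 2 * a := by
  have htend : Filter.Tendsto (fun k : ℕ => W * (2⁻¹ : ℝ≥0∞) ^ k) Filter.atTop (nhds 0) := by
    have := ENNReal.Tendsto.const_mul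
      (ENNReal.tendsto_pow_atTop_nhds_zero_of_lt_one (r := 2⁻¹) (by simp)) (Or.inr hW)
    simpa using this
  have hex : ∃ k : ℕ, W * 2⁻¹ ^ k < a :=
    (htend.eventually (gt_mem_nhds (pos_iff_ne_zero.2 ha))).exists
  classical
  have h0 : Nat.find hex ≠ 0 := fun h => by
    have := Nat.find_spec hex
    rw [h] at this
    simp only [pow_zero, mul_one] at this
    exact this.not_ge haW
  obtain ⟨k, hk⟩ := Nat.exists_eq_succ_of_ne_zero h0
  refine ⟨k, not_lt.1 (Nat.find_min hex (by omega)), ?_⟩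
  have h1 := (Nat.find_spec hex).le
  rw [hk, Nat.succ_eq_add_one, pow_succ, ← mul_assoc, ← div_eq_mul_inv,
    ENNReal.div_le_iff_le_mul (by simp) (by simp)] at h1
  rwa [mul_comm 2]

/-- Restricted dual form of the weak-type estimate. -/
lemma setLIntegral_tdy_le {d : ℕ} {p q : ℝ} (hp : 1 < p) (hpq : p < q) (τ : DIdx d → ℝ≥0∞)
    {σ ω : (Fin d → ℝ) → ℝ≥0∞} (hσ : Measurable σ)
    (hω : ∀ i : DIdx d, wMeasure ω (dcube i) ≠ ⊤)
    {f : (Fin d → ℝ) → ℝ≥0∞} (hf : Measurable f) {E : Set (Fin d → ℝ)} (hE : MeasurableSet E)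
    (hEt : wMeasure ω E ≠ ⊤) :
    ∫⁻ x in E, Tdy τ (fun y => f y * σ y) x ∂wMeasure ω ≤
      2 * (1 - (2⁻¹ : ℝ≥0∞) ^ (1 / p - 1 / q))⁻¹ * gloTest p q τ σ ω * lpn p (wMeasure σ) f *
        wMeasure ω E ^ (1 - 1 / q) := by
  have hp0 : 0 < p := by linarith
  have hq : 1 < q := hp.trans hpq
  have hpr : p.HolderConjugate (p / (p - 1)) := Real.HolderConjugate.conjExponent hp
  set r := p / (p - 1) with hr_def
  have hr : 0 < r := hpr.symm.pos
  set θ := 1 / p - 1 / q with hθ_def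
  have hθ : 0 < θ := sub_pos.2 (one_div_lt_one_div_of_lt hp0 hpq)
  have hinv : 1 / r = 1 - 1 / p := by
    have := hpr.inv_add_inv_eq_one
    rw [one_div, one_div]; linarith
  have hrt : r * (1 - 1 / q) = 1 + r * θ := by
    have h1 : r * (1 / r) = 1 := mul_one_div_cancel hr.ne'
    rw [hinv] at h1
    rw [hθ_def]; linarith
  set μ := wMeasure σ
  set ν := wMeasure ω
  set W := ν E
  set G := gloTest p q τ σ ω
  rcases eq_or_ne W 0 with hW0 | hW0
  · rw [Measure.restrict_eq_zero.2 hW0]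
    simp
  set c : DIdx d → ℝ≥0∞ := fun i => τ i * lavg i (fun y => f y * σ y) * ν (E ∩ dcube i) with hc
  have hint : ∫⁻ x in E, Tdy τ (fun y => f y * σ y) x ∂ν = ∑' i, c i := by
    simp only [Tdy]
    rw [lintegral_tsum fun i =>
      (measurable_const.indicator (measurableSet_dcube i)).aemeasurable]
    refine tsum_congr fun i => ?_
    rw [lintegral_indicator_const (measurableSet_dcube i),
      Measure.restrict_apply (measurableSet_dcube i), Set.inter_comm]
  let L : ℕ → Set (DIdx d) := fun k =>
    {i | ν (E ∩ dcube i) ≤ W * 2⁻¹ ^ k ∧ W * 2⁻¹ ^ k ≤ 2 * ν (E ∩ dcube i)}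
  have hlayer : ∀ i, c i ≤ ∑' k, (L k).indicator c i := by
    intro i
    rcases eq_or_ne (ν (E ∩ dcube i)) 0 with h0 | h0
    · simp [hc, h0]
    · obtain ⟨k, hk⟩ := exists_nat_le_mul_inv_two_pow h0 (measure_mono Set.inter_subset_left) hEt
      calc c i = (L k).indicator c i := (Set.indicator_of_mem (show i ∈ L k from hk) c).symm
        _ ≤ _ := ENNReal.le_tsum k
  have hbound : ∀ k, ∑' i, (L k).indicator c i ≤
      2 * G * lpn p μ f * W ^ (1 - 1 / q) * (2⁻¹ ^ θ) ^ k := by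
    intro k
    classical
    rw [ENNReal.tsum_eq_iSup_sum]
    refine iSup_le fun F => ?_
    simp only [Set.indicator_apply]
    rw [← Finset.sum_filter]
    set F' := F.filter (· ∈ L k)
    set g : DIdx d → (Fin d → ℝ) → ℝ≥0∞ := fun i => (dcube i).indicator
      (fun _ => τ i * ν (E ∩ dcube i) / volume (dcube i)) with hg
    have hgm : ∀ i, Measurable (g i) := fun i =>
      measurable_const.indicator (measurableSet_dcube i)
    have hmem : ∀ i ∈ F', i ∈ L k := fun i hi => (Finset.mem_filter.1 hi).2
    have hrp := lintegral_layer_rpow_le hr hθ.le hrt τ μ ν G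
      (fun R a ha => mul_lpn_kerOut_le hp hq τ σ ω hω R ha) hE (W * 2⁻¹ ^ k) F'
      (fun i hi => (hmem i hi).1) (fun i hi => (hmem i hi).2)
    have hnorm : lpn r μ (fun x => ∑ i ∈ F', g i x) ≤
        2 * G * W ^ (1 - 1 / q) * (2⁻¹ ^ θ) ^ k := by
      calc lpn r μ (fun x => ∑ i ∈ F', g i x)
          ≤ ((2 * G * (W * 2⁻¹ ^ k) ^ θ) ^ r * W) ^ (1 / r) :=
            ENNReal.rpow_le_rpow hrp (by positivity)
        _ = 2 * G * (W * 2⁻¹ ^ k) ^ θ * W ^ (1 / r) := by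
            rw [ENNReal.mul_rpow_of_nonneg _ _ (by positivity), ← ENNReal.rpow_mul,
              mul_one_div_cancel hr.ne', ENNReal.rpow_one]
        _ = 2 * G * (W ^ θ * W ^ (1 / r)) * (2⁻¹ ^ θ) ^ k := by
            rw [ENNReal.mul_rpow_of_nonneg _ _ hθ.le, ← ENNReal.rpow_natCast,
              ← ENNReal.rpow_natCast, ← ENNReal.rpow_mul, ← ENNReal.rpow_mul, mul_comm θ]
            ring
        _ = 2 * G * W ^ (1 - 1 / q) * (2⁻¹ ^ θ) ^ k := by
            rw [← ENNReal.rpow_add _ _ hW0 hEt, hinv, hθ_def]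
            ring_nf
    calc ∑ i ∈ F', c i = ∑ i ∈ F', ∫⁻ x, g i x * f x ∂μ := by
          refine Finset.sum_congr rfl fun i _ => ?_
          rw [hg, lintegral_indicator_mul_wMeasure hσ hf, hc]
          ring
      _ = ∫⁻ x, ((fun x => ∑ i ∈ F', g i x) * f) x ∂μ := by
          simp only [Pi.mul_apply, Finset.sum_mul]
          exact (lintegral_finsetSum F' fun i _ => (hgm i).mul hf).symm
      _ ≤ lpn r μ (fun x => ∑ i ∈ F', g i x) * lpn p μ f :=
          ENNReal.lintegral_mul_le_Lp_mul_Lq μ hpr.symm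
            (Finset.measurable_sum _ fun i _ => hgm i).aemeasurable hf.aemeasurable
      _ ≤ 2 * G * W ^ (1 - 1 / q) * (2⁻¹ ^ θ) ^ k * lpn p μ f := by gcongr
      _ = _ := by ring
  calc ∫⁻ x in E, Tdy τ (fun y => f y * σ y) x ∂ν = ∑' i, c i := hint
    _ ≤ ∑' i, ∑' k, (L k).indicator c i := ENNReal.tsum_le_tsum hlayer
    _ = ∑' k, ∑' i, (L k).indicator c i := ENNReal.tsum_comm
    _ ≤ ∑' k : ℕ, 2 * G * lpn p μ f * W ^ (1 - 1 / q) * (2⁻¹ ^ θ) ^ k :=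
      ENNReal.tsum_le_tsum hbound
    _ = _ := by
      rw [ENNReal.tsum_mul_left, ENNReal.tsum_geometric]
      ring

lemma measurable_tdy {d : ℕ} (τ : DIdx d → ℝ≥0∞) (f : (Fin d → ℝ) → ℝ≥0∞) :
    Measurable (Tdy τ f) :=
  Measurable.tsum fun i => measurable_const.indicator (measurableSet_dcube i)

lemma weakConst_le_gloTest {d : ℕ} {p q : ℝ} (hp : 1 < p) (hpq : p < q) (τ : DIdx d → ℝ≥0∞)
    {σ ω : (Fin d → ℝ) → ℝ≥0∞} (hσ : Measurable σ)
    (hωt : ∀ i : DIdx d, wMeasure ω (dcube i) ≠ ⊤) :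
    weakConst p q τ σ ω ≤
      2 * (1 - (2⁻¹ : ℝ≥0∞) ^ (1 / p - 1 / q))⁻¹ * gloTest p q τ σ ω := by
  have := sigmaFinite_of_dcube_ne_top hωt
  have hq0 : 0 < q := by linarith
  refine sInf_le fun f hf _ lam hlam => ?_
  set ν := wMeasure ω
  set A := {x | lam < Tdy τ (fun y => f y * σ y) x}
  have hA : MeasurableSet A := measurableSet_lt measurable_const (measurable_tdy τ _)
  rcases eq_or_ne lam ⊤ with rfl | hlt
  · simp [A]
  rw [← Measure.iSup_restrict_spanningSets A]
  refine iSup_le fun n => ?_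
  rw [Measure.restrict_apply hA]
  set E := A ∩ spanningSets ν n
  have hE : MeasurableSet E := hA.inter (measurableSet_spanningSets ν n)
  have hEt : ν E ≠ ⊤ :=
    ((measure_mono Set.inter_subset_right).trans_lt (measure_spanningSets_lt_top ν n)).ne
  rcases eq_or_ne (ν E) 0 with h0 | h0
  · rw [h0]; exact zero_le
  rw [← ENNReal.rpow_inv_le_iff hq0, ← one_div,
    ENNReal.le_div_iff_mul_le (Or.inl hlam.ne') (Or.inl hlt)]
  have hpow0 : ν E ^ (1 - 1 / q) ≠ 0 := by simp [h0, hEt]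
  have hpowt : ν E ^ (1 - 1 / q) ≠ ⊤ := by simp [h0, hEt]
  refine (ENNReal.mul_le_mul_iff_left hpow0 hpowt).1 ?_
  calc ν E ^ (1 / q) * lam * ν E ^ (1 - 1 / q) = lam * ν E := by
        rw [mul_right_comm, ← ENNReal.rpow_add _ _ h0 hEt, add_sub_cancel, ENNReal.rpow_one,
          mul_comm]
    _ = ∫⁻ _ in E, lam ∂ν := by simp
    _ ≤ ∫⁻ x in E, Tdy τ (fun y => f y * σ y) x ∂ν :=
        setLIntegral_mono' hE fun x hx => (show lam < _ from hx.1).le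
    _ ≤ _ := setLIntegral_tdy_le hp hpq τ hσ hωt hf hE hEt

/-- **Weak-type characterization by global testing, `1 < p < q < ∞`.** -/
theorem stmt5 (d : ℕ) (p q : ℝ) (hp : 1 < p) (hpq : p < q) :
    ∃ c C : ℝ≥0∞, 0 < c ∧ c < ⊤ ∧ 0 < C ∧ C < ⊤ ∧
      ∀ (τ : DIdx d → ℝ≥0∞) (σ ω : (Fin d → ℝ) → ℝ≥0∞),
        Measurable σ → Measurable ω →
        (∀ i : DIdx d, wMeasure σ (dcube i) ≠ ⊤) →
        (∀ i : DIdx d, wMeasure ω (dcube i) ≠ ⊤) →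
        c * gloTest p q τ σ ω ≤ weakConst p q τ σ ω ∧
          weakConst p q τ σ ω ≤ C * gloTest p q τ σ ω := by
  have hθ : 0 < 1 / p - 1 / q :=
    sub_pos.2 (one_div_lt_one_div_of_lt (by linarith) hpq)
  have hlt : (2⁻¹ : ℝ≥0∞) ^ (1 / p - 1 / q) < 1 := ENNReal.rpow_lt_one (by simp) hθ
  refine ⟨1, 2 * (1 - (2⁻¹ : ℝ≥0∞) ^ (1 / p - 1 / q))⁻¹, one_pos, one_lt_top, ?_, ?_,
    fun τ σ ω hσ _ hσt hωt => ⟨?_, weakConst_le_gloTest hp hpq τ hσ hωt⟩⟩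
  · simp [pos_iff_ne_zero]
  · exact ENNReal.mul_lt_top (by simp) (ENNReal.inv_lt_top.2 (tsub_pos_of_lt hlt))
  · rw [one_mul]
    exact gloTest_le_weakConst hp (hp.trans hpq) τ hσ hσt hωt
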